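/- arXiv:math/0505466 — 3 statements merged into one kernel-verified Lean document; each statement's English description precedes it below -/
import Mathlib

section
/- Let C be a semi-dualizing (R,S)-bimodule. If 0 → L₁ → L₂ → L₃ → 0 is a short exact sequence of finitely generated left R-modules with L₃ C-reflexive, then L₁ is C-reflexive if and only if L₂ is C-reflexive. -/
open CategoryTheory

/-- The `i`-th Ext group of finitely generated modules, as a module over `ℤ`. -/
noncomputable abbrev ExtGrp (A : Type) [Ring A] (i : ℕ) (M N : Type) [AddCommGroup M] [Module A M]
    [AddCommGroup N] [Module A N] : Type :=
  ((Ext ℤ (ModuleCat.{0} A) i).obj (Opposite.op (ModuleCat.of A M))).obj (ModuleCat.of A N)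

section Bimodule

variable (R S : Type) [Ring R] [Ring S]
variable (C : Type) [AddCommGroup C] [Module R C] [Module Sᵐᵒᵖ C]
  [SMulCommClass R Sᵐᵒᵖ C] [SMulCommClass Sᵐᵒᵖ R C]

/-- right homothety `S → Hom_R(C,C)`. -/
def rightHomothety (s : S) : C →ₗ[R] C where
  toFun c := MulOpposite.op s • c
  map_add' := smul_add _
  map_smul' r c := smul_comm _ r c

/-- left homothety `R → Hom_S(C,C)`. -/
def leftHomothety (r : R) : C →ₗ[Sᵐᵒᵖ] C where
  toFun c := r • c
  map_add' := smul_add _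
  map_smul' s c := smul_comm _ s c

/-- `C` is a semi-dualizing `(R,S)`-bimodule. -/
structure IsSemidualizing : Prop where
  bij_right : Function.Bijective (rightHomothety R S C)
  bij_left : Function.Bijective (leftHomothety R S C)
  ext_right : ∀ i : ℕ, 0 < i → Subsingleton (ExtGrp R i C C)
  ext_left : ∀ i : ℕ, 0 < i → Subsingleton (ExtGrp Sᵐᵒᵖ i C C)

variable (M : Type) [AddCommGroup M] [Module R M]

/-- the biduality (evaluation) map `M → Hom_S(Hom_R(M,C),C)`. -/
def bidualityMap (m : M) : (M →ₗ[R] C) →ₗ[Sᵐᵒᵖ] C where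
  toFun f := f m
  map_add' _ _ := rfl
  map_smul' _ _ := rfl

/-- a finitely generated left `R`-module `M` is `C`-reflexive. -/
structure IsCReflexive : Prop where
  ext_vanish : ∀ i : ℕ, 0 < i → Subsingleton (ExtGrp R i M C)
  ext_dual_vanish : ∀ i : ℕ, 0 < i → Subsingleton (ExtGrp Sᵐᵒᵖ i (M →ₗ[R] C) C)
  bij : Function.Bijective (bidualityMap R S C M)

variable (N : Type) [AddCommGroup N] [Module Sᵐᵒᵖ N]

/-- the biduality map `N → Hom_R(Hom_S(N,C),C)` for a right `S`-module `N`. -/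
def bidualityMapRight (n : N) : (N →ₗ[Sᵐᵒᵖ] C) →ₗ[R] C where
  toFun f := f n
  map_add' _ _ := rfl
  map_smul' _ _ := rfl

/-- a finitely generated right `S`-module `N` is `C`-reflexive. -/
structure IsCReflexiveRight : Prop where
  ext_vanish : ∀ i : ℕ, 0 < i → Subsingleton (ExtGrp Sᵐᵒᵖ i N C)
  ext_dual_vanish : ∀ i : ℕ, 0 < i → Subsingleton (ExtGrp R i (N →ₗ[Sᵐᵒᵖ] C) C)
  bij : Function.Bijective (bidualityMapRight R S C N)

end Bimodule

section Helpers

lemma extGrp_iff (A : Type) [Ring A] (n : ℕ) (M N : Type) [AddCommGroup M] [Module A M]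
    [AddCommGroup N] [Module A N] :
    Subsingleton (ExtGrp A (n + 1) M N) ↔
      Subsingleton (Abelian.Ext.{0} (ModuleCat.of A M) (ModuleCat.of A N) (n + 1)) := by
  let P := ProjectiveResolution.of (ModuleCat.of A M)
  have h1 : Subsingleton (ExtGrp A (n + 1) M N) ↔
      ∀ u : P.complex.X (n + 1) ⟶ ModuleCat.of A N, P.complex.d (n + 2) (n + 1) ≫ u = 0 →
        ∃ v : P.complex.X n ⟶ ModuleCat.of A N, P.complex.d (n + 1) n ≫ v = u := by
    have e := P.isoExt (R := ℤ) (n + 1) (ModuleCat.of A N)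
    rw [← ModuleCat.isZero_iff_subsingleton, e.isZero_iff,
      ← HomologicalComplex.exactAt_iff_isZero_homology,
      HomologicalComplex.exactAt_iff' _ n (n + 1) (n + 2) (by simp) (by simp),
      ShortComplex.moduleCat_exact_iff]
    rfl
  rw [h1]
  constructor
  · intro h
    refine subsingleton_of_forall_eq 0 fun x => ?_
    obtain ⟨u, hu, rfl⟩ := P.extMk_surjective x (n + 2) rfl
    rw [P.extMk_eq_zero_iff u _ rfl hu n rfl]
    exact h u hu
  · intro h u hu
    exact (P.extMk_eq_zero_iff u _ rfl hu n rfl).1 (Subsingleton.elim _ _)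

variable {A : Type} [Ring A] {L₁ L₂ L₃ : Type}
    [AddCommGroup L₁] [Module A L₁] [AddCommGroup L₂] [Module A L₂] [AddCommGroup L₃] [Module A L₃]
    (N : Type) [AddCommGroup N] [Module A N]
    (f : L₁ →ₗ[A] L₂) (g : L₂ →ₗ[A] L₃)
    (hf : Function.Injective f) (hg : Function.Surjective g) (hfg : Function.Exact f g)

/-- the short complex -/
abbrev sesC (hfg : Function.Exact f g) : ShortComplex (ModuleCat.{0} A) :=
  ShortComplex.mk (ModuleCat.ofHom f) (ModuleCat.ofHom g) (by
    ext x; exact hfg.apply_apply_eq_zero x)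

include hf hg hfg

lemma sesC_exact : (sesC f g hfg).ShortExact where
  exact := by
    rw [ShortComplex.moduleCat_exact_iff]
    intro x hx
    exact (hfg x).1 hx
  mono_f := (ModuleCat.mono_iff_injective _).2 hf
  epi_g := (ModuleCat.epi_iff_surjective _).2 hg

lemma ext_mid (n : ℕ) (h1 : Subsingleton (ExtGrp A (n + 1) L₁ N))
    (h3 : Subsingleton (ExtGrp A (n + 1) L₃ N)) : Subsingleton (ExtGrp A (n + 1) L₂ N) := by
  rw [extGrp_iff] at *
  refine subsingleton_of_forall_eq 0 fun x => ?_
  obtain ⟨y, rfl⟩ := Abelian.Ext.contravariant_sequence_exact₂ (sesC_exact f g hf hg hfg) _ x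
    (h1.elim _ _)
  rw [show y = 0 from h3.elim _ _, Abelian.Ext.comp_zero]

lemma ext_left (n : ℕ) (h2 : Subsingleton (ExtGrp A (n + 1) L₂ N))
    (h3 : Subsingleton (ExtGrp A (n + 2) L₃ N)) : Subsingleton (ExtGrp A (n + 1) L₁ N) := by
  rw [extGrp_iff] at *
  refine subsingleton_of_forall_eq 0 fun x => ?_
  obtain ⟨y, rfl⟩ := Abelian.Ext.contravariant_sequence_exact₁ (sesC_exact f g hf hg hfg) _ x
    (n₁ := n + 2) (by omega) (h3.elim _ _)
  rw [show y = 0 from h2.elim _ _, Abelian.Ext.comp_zero]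

lemma ext_right (n : ℕ) (h1 : Subsingleton (ExtGrp A (n + 1) L₁ N))
    (h2 : Subsingleton (ExtGrp A (n + 2) L₂ N)) : Subsingleton (ExtGrp A (n + 2) L₃ N) := by
  rw [extGrp_iff] at *
  refine subsingleton_of_forall_eq 0 fun x => ?_
  obtain ⟨y, rfl⟩ := Abelian.Ext.contravariant_sequence_exact₃ (sesC_exact f g hf hg hfg) _ x
    (h2.elim _ _) (n₀ := n + 1) (by omega)
  rw [show y = 0 from h1.elim _ _, Abelian.Ext.comp_zero]

lemma ext_right_one (h1 : ∀ u : L₁ →ₗ[A] N, ∃ v : L₂ →ₗ[A] N, v.comp f = u)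
    (h2 : Subsingleton (ExtGrp A 1 L₂ N)) : Subsingleton (ExtGrp A 1 L₃ N) := by
  rw [extGrp_iff A 0] at *
  refine subsingleton_of_forall_eq 0 fun x => ?_
  have hS := sesC_exact f g hf hg hfg
  obtain ⟨y, rfl⟩ := Abelian.Ext.contravariant_sequence_exact₃ hS _ x
    (h2.elim _ _) (n₀ := 0) rfl
  obtain ⟨u, rfl⟩ := (Abelian.Ext.mk₀_bijective _ _).2 y
  obtain ⟨v, hv⟩ := h1 u.hom
  have : u = (sesC f g hfg).f ≫ (ModuleCat.ofHom v : (sesC f g hfg).X₂ ⟶ _) := by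
    ext x
    exact (LinearMap.congr_fun hv x).symm
  rw [this, ← Abelian.Ext.mk₀_comp_mk₀]
  exact hS.extClass_comp_assoc _

lemma extend_of_ext (h3 : Subsingleton (ExtGrp A 1 L₃ N)) (u : L₁ →ₗ[A] N) :
    ∃ v : L₂ →ₗ[A] N, v.comp f = u := by
  rw [extGrp_iff A 0] at *
  have hS := sesC_exact f g hf hg hfg
  obtain ⟨y, hy⟩ := Abelian.Ext.contravariant_sequence_exact₁ hS (ModuleCat.of A N)
    (Abelian.Ext.mk₀ (ModuleCat.ofHom u : (sesC f g hfg).X₁ ⟶ _))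
    (n₁ := 1) rfl (h3.elim _ _)
  obtain ⟨v, rfl⟩ := (Abelian.Ext.mk₀_bijective _ _).2 y
  rw [Abelian.Ext.mk₀_comp_mk₀] at hy
  have hy := (Abelian.Ext.mk₀_bijective _ _).1 hy
  refine ⟨v.hom, ?_⟩
  ext x
  exact ConcreteCategory.congr_hom hy x

end Helpers

section Dual

variable (R S : Type) [Ring R] [Ring S]
variable (C : Type) [AddCommGroup C] [Module R C] [Module Sᵐᵒᵖ C]
  [SMulCommClass R Sᵐᵒᵖ C] [SMulCommClass Sᵐᵒᵖ R C]

/-- precomposition as a map of right `S`-modules -/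
def dualMap' {M N : Type} [AddCommGroup M] [Module R M] [AddCommGroup N] [Module R N]
    (f : M →ₗ[R] N) : (N →ₗ[R] C) →ₗ[Sᵐᵒᵖ] (M →ₗ[R] C) where
  toFun u := u.comp f
  map_add' _ _ := rfl
  map_smul' _ _ := rfl

end Dual

/-- two-out-of-three for `C`-reflexivity in a short exact sequence
with `C`-reflexive cokernel. -/
theorem reflexive_two_of_three
    (R S : Type) [Ring R] [IsNoetherianRing R] [Ring S] [IsNoetherianRing Sᵐᵒᵖ]
    (C : Type) [AddCommGroup C] [Module R C] [Module Sᵐᵒᵖ C]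
    [SMulCommClass R Sᵐᵒᵖ C] [SMulCommClass Sᵐᵒᵖ R C]
    [Module.Finite R C] [Module.Finite Sᵐᵒᵖ C]
    (hC : IsSemidualizing R S C)
    (L₁ L₂ L₃ : Type)
    [AddCommGroup L₁] [Module R L₁] [Module.Finite R L₁]
    [AddCommGroup L₂] [Module R L₂] [Module.Finite R L₂]
    [AddCommGroup L₃] [Module R L₃] [Module.Finite R L₃]
    (f : L₁ →ₗ[R] L₂) (g : L₂ →ₗ[R] L₃)
    (hf : Function.Injective f) (hg : Function.Surjective g)
    (hfg : Function.Exact f g)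
    (h₃ : IsCReflexive R S C L₃) :
    IsCReflexive R S C L₁ ↔ IsCReflexive R S C L₂ := by
  have ext3 := extend_of_ext C f g hf hg hfg (h₃.ext_vanish 1 one_pos)
  let F := dualMap' R S C f
  let G := dualMap' R S C g
  have hG : Function.Injective G := by
    intro u v h
    ext x
    obtain ⟨y, rfl⟩ := hg x
    exact LinearMap.congr_fun h y
  have hF : Function.Surjective F := ext3
  have hGF : Function.Exact G F := by
    intro u
    constructor
    · intro h
      have hk : LinearMap.ker g ≤ LinearMap.ker u := by
        intro x hx
        obtain ⟨y, rfl⟩ := (hfg x).1 hx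
        exact LinearMap.congr_fun h y
      refine ⟨((LinearMap.ker g).liftQ u hk).comp
        (g.quotKerEquivOfSurjective hg).symm.toLinearMap, ?_⟩
      ext x
      have : (g.quotKerEquivOfSurjective hg).symm (g x) = Submodule.Quotient.mk x := by
        rw [LinearEquiv.symm_apply_eq]; rfl
      change ((LinearMap.ker g).liftQ u hk) ((g.quotKerEquivOfSurjective hg).symm (g x)) = u x
      rw [this]; rfl
    · rintro ⟨v, rfl⟩
      ext x
      change v (g (f x)) = 0
      rw [hfg.apply_apply_eq_zero, map_zero]
  have bsub : ∀ (x y : L₂), bidualityMap R S C L₂ (x - y) =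
      bidualityMap R S C L₂ x - bidualityMap R S C L₂ y := by
    intro x y; ext u; exact map_sub u x y
  constructor
  · intro h₁
    have e2 : ∀ i : ℕ, 0 < i → Subsingleton (ExtGrp R i L₂ C) := by
      rintro (_ | i) hi
      · exact absurd hi (lt_irrefl _)
      exact ext_mid C f g hf hg hfg i (h₁.ext_vanish _ hi) (h₃.ext_vanish _ hi)
    refine ⟨e2, ?_, ?_, ?_⟩
    · rintro (_ | i) hi
      · exact absurd hi (lt_irrefl _)
      exact ext_mid C G F hG hF hGF i (h₃.ext_dual_vanish _ hi) (h₁.ext_dual_vanish _ hi)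
    · intro x y hxy
      have hz : bidualityMap R S C L₂ (x - y) = 0 := by rw [bsub, hxy, sub_self]
      have hz' : ∀ u : L₂ →ₗ[R] C, u (x - y) = 0 := fun u => LinearMap.congr_fun hz u
      have hgz : g (x - y) = 0 := by
        apply h₃.bij.1
        ext u
        change u (g (x - y)) = u 0
        rw [map_zero]
        exact hz' (u.comp g)
      obtain ⟨w, hw⟩ := (hfg _).1 hgz
      have : w = 0 := by
        apply h₁.bij.1
        ext u
        obtain ⟨v, rfl⟩ := ext3 u
        change v (f w) = v (f 0)
        rw [hw, hz', map_zero, map_zero]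
      rw [← sub_eq_zero, ← hw, this, map_zero]
    · intro φ
      obtain ⟨z, hz⟩ := h₃.bij.2 (φ.comp G)
      obtain ⟨y, rfl⟩ := hg z
      -- ψ = φ - ev y vanishes on the image of G
      let ψ := φ - bidualityMap R S C L₂ y
      have hψ : ∀ u, ψ (G u) = 0 := by
        intro u
        have := LinearMap.congr_fun hz u
        change φ (G u) - u (g y) = 0
        rw [sub_eq_zero]
        exact this.symm
      have hk : LinearMap.ker F ≤ LinearMap.ker ψ := by
        intro u hu
        obtain ⟨v, rfl⟩ := (hGF u).1 hu
        exact hψ v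
      obtain ⟨w, hw⟩ := h₁.bij.2 (((LinearMap.ker F).liftQ ψ hk).comp
        (F.quotKerEquivOfSurjective hF).symm.toLinearMap)
      refine ⟨f w + y, ?_⟩
      ext u
      have h1 := LinearMap.congr_fun hw (F u)
      have h2 : (F.quotKerEquivOfSurjective hF).symm (F u) = Submodule.Quotient.mk u := by
        rw [LinearEquiv.symm_apply_eq]; rfl
      have h3 : u (f w) = φ u - u y := by
        refine h1.trans ?_
        change ((LinearMap.ker F).liftQ ψ hk) ((F.quotKerEquivOfSurjective hF).symm (F u)) = _
        rw [h2]; rfl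
      change u (f w + y) = φ u
      rw [map_add, h3, sub_add_cancel]
  · intro h₂
    refine ⟨?_, ?_, ?_, ?_⟩
    · rintro (_ | i) hi
      · exact absurd hi (lt_irrefl _)
      exact ext_left C f g hf hg hfg i (h₂.ext_vanish _ hi) (h₃.ext_vanish _ (Nat.succ_pos _))
    · rintro (_ | _ | i) hi
      · exact absurd hi (lt_irrefl _)
      · refine ext_right_one C G F hG hF hGF ?_ (h₂.ext_dual_vanish 1 one_pos)
        intro u
        obtain ⟨z, rfl⟩ := h₃.bij.2 u
        obtain ⟨y, rfl⟩ := hg z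
        exact ⟨bidualityMap R S C L₂ y, rfl⟩
      · exact ext_right C G F hG hF hGF i (h₃.ext_dual_vanish _ (Nat.succ_pos _))
          (h₂.ext_dual_vanish _ hi)
    · intro x y hxy
      apply hf
      apply h₂.bij.1
      ext u
      exact LinearMap.congr_fun hxy (F u)
    · intro φ
      obtain ⟨y, hy⟩ := h₂.bij.2 (φ.comp F)
      have hy' : ∀ u : L₂ →ₗ[R] C, u y = φ (F u) := fun u => LinearMap.congr_fun hy u
      have hgy : g y = 0 := by
        apply h₃.bij.1
        ext u
        change u (g y) = u 0
        rw [map_zero]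
        refine (hy' (G u)).trans ?_
        rw [hGF.apply_apply_eq_zero, map_zero]
      obtain ⟨w, rfl⟩ := (hfg y).1 hgy
      refine ⟨w, ?_⟩
      ext u
      obtain ⟨v, rfl⟩ := hF u
      exact hy' v
end

section
/- Let C be a semi-dualizing (R,S)-bimodule and M a finitely generated left R-module. If there exists an exact sequence 0 → X^{-n} → ⋯ → X^0 → M → 0 with each X^i C-reflexive, then for any projective resolution ⋯ → P^{-m-1} → P^{-m} → ⋯ → P^0 → M → 0 and any m ≥ n, the cokernel of P^{-m-1} → P^{-m} is a C-reflexive R-module. -/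
open CategoryTheory

section Resolutions

variable (R : Type) [Ring R]

/-- An exact sequence `⋯ → X^{-(j+1)} → X^{-j} → ⋯ → X^0 → M → 0` of finitely
generated left `R`-modules (a resolution of `M`); `X j` sits in cohomological
degree `-j`. -/
structure FGResolution (M : Type) [AddCommGroup M] [Module R M] where
  X : ℕ → Type
  [acg : ∀ j, AddCommGroup (X j)]
  [mod : ∀ j, Module R (X j)]
  fin : ∀ j, Module.Finite R (X j)
  d : ∀ j, X (j + 1) →ₗ[R] X j
  aug : X 0 →ₗ[R] M
  surj : Function.Surjective aug
  exact_aug : Function.Exact (d 0) aug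
  exact : ∀ j, Function.Exact (d (j + 1)) (d j)

attribute [instance] FGResolution.acg FGResolution.mod

/-- The resolution has length at most `n`, i.e. it is of the form
`0 → X^{-n} → ⋯ → X^0 → M → 0`. -/
def FGResolution.LengthLE {M : Type} [AddCommGroup M] [Module R M]
    (res : FGResolution R M) (n : ℕ) : Prop :=
  ∀ j, n < j → Subsingleton (res.X j)

end Resolutions

lemma legacy_iff (A : Type) [Ring A] (n : ℕ) (M N : Type) [AddCommGroup M] [Module A M]
    [AddCommGroup N] [Module A N] : Subsingleton (ExtGrp A (n+1) M N) ↔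
    Subsingleton (Abelian.Ext.{0} (ModuleCat.of A M) (ModuleCat.of A N) (n+1)) := by
  let Q := projectiveResolution (ModuleCat.of A M)
  trans ∀ f : Q.complex.X (n+1) ⟶ ModuleCat.of A N, Q.complex.d (n+2) (n+1) ≫ f = 0 →
      ∃ g : Q.complex.X n ⟶ ModuleCat.of A N, Q.complex.d (n+1) n ≫ g = f
  · have e := Q.isoExt (R := ℤ) (n+1) (ModuleCat.of A N)
    rw [ExtGrp, e.toLinearEquiv.toEquiv.subsingleton_congr, ← ModuleCat.isZero_iff_subsingleton,
      ← HomologicalComplex.exactAt_iff_isZero_homology,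
      HomologicalComplex.exactAt_iff' _ n (n+1) (n+2) (by simp) (by simp),
      ShortComplex.moduleCat_exact_iff]
    rfl
  · constructor
    · intro h
      refine subsingleton_of_forall_eq 0 fun x => ?_
      obtain ⟨f, hf, rfl⟩ := Q.extMk_surjective x (n+2) rfl
      rw [Q.extMk_eq_zero_iff _ _ _ _ n rfl]
      exact h f hf
    · intro h f hf
      exact (Q.extMk_eq_zero_iff f (n+2) rfl hf n rfl).1 (Subsingleton.elim _ _)

/-- All positive Ext groups vanish. -/
def EV (A M N : Type) [Ring A] [AddCommGroup M] [Module A M] [AddCommGroup N] [Module A N] : Prop :=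
  ∀ n : ℕ, Subsingleton (Abelian.Ext.{0} (ModuleCat.of A M) (ModuleCat.of A N) (n+1))

section EVsec

variable {A : Type} [Ring A] {K X Y N : Type} [AddCommGroup K] [Module A K]
  [AddCommGroup X] [Module A X] [AddCommGroup Y] [Module A Y] [AddCommGroup N] [Module A N]

lemma EV_iff : EV A X N ↔ ∀ i : ℕ, 0 < i → Subsingleton (ExtGrp A i X N) := by
  constructor
  · intro h i hi
    obtain ⟨n, rfl⟩ : ∃ n, i = n + 1 := ⟨i - 1, by omega⟩
    exact (legacy_iff A n X N).2 (h n)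
  · intro h n
    exact (legacy_iff A n X N).1 (h (n+1) (by omega))

/-- short complex attached to two composable maps -/
abbrev mkSC (i : K →ₗ[A] X) (p : X →ₗ[A] Y) (h : Function.Exact i p) :
    ShortComplex (ModuleCat.{0} A) :=
  ShortComplex.mk (ModuleCat.ofHom i) (ModuleCat.ofHom p) (by
    ext x; exact h.apply_apply_eq_zero x)

lemma mkSC_shortExact (i : K →ₗ[A] X) (p : X →ₗ[A] Y) (hi : Function.Injective i)
    (h : Function.Exact i p) (hp : Function.Surjective p) : (mkSC i p h).ShortExact where
  exact := (ShortComplex.ShortExact.moduleCat_exact_iff_function_exact _).mpr h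
  mono_f := (ModuleCat.mono_iff_injective _).2 hi
  epi_g := (ModuleCat.epi_iff_surjective _).2 hp

variable (i : K →ₗ[A] X) (p : X →ₗ[A] Y) (hi : Function.Injective i)
    (h : Function.Exact i p) (hp : Function.Surjective p)

include hi h hp

lemma hom_surj_of_EV (hY : EV A Y N) (f : K →ₗ[A] N) : ∃ g : X →ₗ[A] N, g ∘ₗ i = f := by
  have hS := mkSC_shortExact i p hi h hp
  have := hY 0
  obtain ⟨x, hx⟩ := Abelian.Ext.contravariant_sequence_exact₁ hS (ModuleCat.of A N)
    (Abelian.Ext.mk₀ (ModuleCat.ofHom f)) (n₁ := 0 + 1) rfl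
    (Subsingleton.elim (α := Abelian.Ext.{0} (ModuleCat.of A Y) (ModuleCat.of A N) (0+1)) _ _)
  obtain ⟨g, rfl⟩ := Abelian.Ext.homEquiv₀.symm.surjective x
  refine ⟨g.hom, ?_⟩
  rw [Abelian.Ext.homEquiv₀_symm_apply, Abelian.Ext.mk₀_comp_mk₀] at hx
  have := Abelian.Ext.homEquiv₀.symm.injective hx
  have := congrArg ModuleCat.Hom.hom this
  simpa using this

lemma EV_left (hX : EV A X N) (hY : EV A Y N) : EV A K N := by
  have hS := mkSC_shortExact i p hi h hp
  intro n
  refine subsingleton_of_forall_eq 0 fun x => ?_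
  have := hY (n+1)
  have := hX n
  obtain ⟨y, hy⟩ := Abelian.Ext.contravariant_sequence_exact₁ hS (ModuleCat.of A N) x
    (n₁ := n + 1 + 1) (by omega)
    (Subsingleton.elim (α := Abelian.Ext.{0} (ModuleCat.of A Y) (ModuleCat.of A N) (n+1+1)) _ _)
  have : y = 0 := 
    Subsingleton.elim (α := Abelian.Ext.{0} (ModuleCat.of A X) (ModuleCat.of A N) (n+1)) _ _
  rw [← hy, this, Abelian.Ext.comp_zero]

lemma EV_mid (hX : EV A K N) (hY : EV A Y N) : EV A X N := by
  have hS := mkSC_shortExact i p hi h hp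
  intro n
  refine subsingleton_of_forall_eq 0 fun x => ?_
  have := hX n
  have := hY n
  obtain ⟨y, hy⟩ := Abelian.Ext.contravariant_sequence_exact₂ hS (ModuleCat.of A N) x
    (Subsingleton.elim (α := Abelian.Ext.{0} (ModuleCat.of A K) (ModuleCat.of A N) (n+1)) _ _)
  have : y = 0 := 
    Subsingleton.elim (α := Abelian.Ext.{0} (ModuleCat.of A Y) (ModuleCat.of A N) (n+1)) _ _
  rw [← hy, this, Abelian.Ext.comp_zero]

lemma EV_right (hK : EV A K N) (hX : EV A X N)
    (hs : ∀ f : K →ₗ[A] N, ∃ g : X →ₗ[A] N, g ∘ₗ i = f) : EV A Y N := by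
  have hS := mkSC_shortExact i p hi h hp
  intro n
  refine subsingleton_of_forall_eq 0 fun x => ?_
  have := hX n
  obtain ⟨y, hy⟩ := Abelian.Ext.contravariant_sequence_exact₃ hS (ModuleCat.of A N) x
    (Subsingleton.elim (α := Abelian.Ext.{0} (ModuleCat.of A X) (ModuleCat.of A N) (n+1)) _ _)
    (n₀ := n) (by omega)
  rw [← hy]
  cases n with
  | succ n =>
    have := hK n
    have : y = 0 := 
      Subsingleton.elim (α := Abelian.Ext.{0} (ModuleCat.of A K) (ModuleCat.of A N) (n+1)) _ _
    rw [this, Abelian.Ext.comp_zero]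
  | zero =>
    obtain ⟨f, rfl⟩ := Abelian.Ext.homEquiv₀.symm.surjective y
    obtain ⟨g, hg⟩ := hs f.hom
    have e : f = (mkSC i p h).f ≫ ModuleCat.ofHom g := by
      ext x
      exact (LinearMap.congr_fun hg x).symm
    rw [Abelian.Ext.homEquiv₀_symm_apply, e, ← Abelian.Ext.mk₀_comp_mk₀]
    exact ShortComplex.ShortExact.extClass_comp_assoc hS _ (h := rfl)

end EVsec

section EV2
variable {A : Type} [Ring A] {X Y N : Type} 
  [AddCommGroup X] [Module A X] [AddCommGroup Y] [Module A Y] [AddCommGroup N] [Module A N]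

lemma EV_retract (s : X →ₗ[A] Y) (r : Y →ₗ[A] X) (h : ∀ x, r (s x) = x) (hY : EV A Y N) :
    EV A X N := by
  intro n
  have := hY n
  refine subsingleton_of_forall_eq 0 fun x => ?_
  have e : ModuleCat.ofHom s ≫ ModuleCat.ofHom r = 𝟙 _ := by ext x; exact h x
  rw [← Abelian.Ext.mk₀_id_comp x, ← e, ← Abelian.Ext.mk₀_comp_mk₀_assoc,
    Subsingleton.elim ((Abelian.Ext.mk₀ (ModuleCat.ofHom r)).comp x (zero_add _)) 0,
    Abelian.Ext.comp_zero]

lemma EV_prod (hX : EV A X N) (hY : EV A Y N) : EV A (X × Y) N :=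
  EV_mid (LinearMap.inl A X Y) (LinearMap.snd A X Y) LinearMap.inl_injective
    Function.Exact.inl_snd LinearMap.snd_surjective hX hY

lemma EV_self : EV A A N := by
  rw [EV_iff]
  intro i hi
  obtain ⟨n, rfl⟩ : ∃ n, i = n + 1 := ⟨i - 1, by omega⟩
  have : Projective (ModuleCat.of A A) := (IsProjective.iff_projective _).1 inferInstance
  exact (ModuleCat.isZero_iff_subsingleton).1 (isZero_Ext_succ_of_projective _ _ n)

end EV2

section Refl

variable {R S : Type} [Ring R] [Ring S] {C : Type} [AddCommGroup C] [Module R C] [Module Sᵐᵒᵖ C]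
  [SMulCommClass R Sᵐᵒᵖ C] [SMulCommClass Sᵐᵒᵖ R C]
variable {K M N : Type} [AddCommGroup K] [Module R K] [AddCommGroup M] [Module R M]
  [AddCommGroup N] [Module R N]

variable (S C) in
/-- dual of a map -/
def dmap (f : M →ₗ[R] N) : (N →ₗ[R] C) →ₗ[Sᵐᵒᵖ] (M →ₗ[R] C) where
  toFun g := g ∘ₗ f
  map_add' _ _ := rfl
  map_smul' _ _ := rfl

lemma refl_iff : IsCReflexive R S C M ↔ EV R M C ∧ EV Sᵐᵒᵖ (M →ₗ[R] C) C ∧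
    Function.Bijective (bidualityMap R S C M) :=
  ⟨fun h => ⟨EV_iff.2 h.1, EV_iff.2 h.2, h.3⟩, fun h => ⟨EV_iff.1 h.1, EV_iff.1 h.2.1, h.2.2⟩⟩

lemma bid_add (x y : M) : bidualityMap R S C M (x + y) =
    bidualityMap R S C M x + bidualityMap R S C M y := by
  ext f; exact map_add f x y

lemma refl_retract (s : M →ₗ[R] N) (r : N →ₗ[R] M) (h : ∀ x, r (s x) = x)
    (hN : IsCReflexive R S C N) : IsCReflexive R S C M := by
  rw [refl_iff] at hN ⊢
  obtain ⟨h1, h2, h3⟩ := hN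
  refine ⟨EV_retract s r h h1, EV_retract (dmap S C r) (dmap S C s) ?_ h2, ?_, ?_⟩
  · intro f; ext x; exact congrArg f (h x)
  · intro x y hxy
    have : s x = s y := h3.1 (by
      ext f
      exact LinearMap.congr_fun hxy (f ∘ₗ s))
    rw [← h x, this, h]
  · intro φ
    obtain ⟨y, hy⟩ := h3.2 (φ ∘ₗ dmap S C s)
    refine ⟨r y, ?_⟩
    ext f
    have := LinearMap.congr_fun hy (f ∘ₗ r)
    refine Eq.trans this ?_
    refine congrArg φ ?_
    ext x; exact congrArg f (h x)

lemma refl_prod (hM : IsCReflexive R S C M) (hN : IsCReflexive R S C N) :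
    IsCReflexive R S C (M × N) := by
  rw [refl_iff] at hM hN ⊢
  refine ⟨EV_prod hM.1 hN.1, ?_, ?_, ?_⟩
  · refine EV_retract 
      ((dmap S C (LinearMap.inl R M N)).prod (dmap S C (LinearMap.inr R M N)))
      ((dmap S C (LinearMap.fst R M N)).coprod (dmap S C (LinearMap.snd R M N))) ?_ 
      (EV_prod hM.2.1 hN.2.1)
    intro f
    ext x <;> simp [dmap, Prod.mk_zero_zero]
  · rintro ⟨x, y⟩ ⟨x', y'⟩ hxy
    refine Prod.ext (hM.2.2.1 ?_) (hN.2.2.1 ?_)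
    · ext f
      exact LinearMap.congr_fun hxy (f ∘ₗ LinearMap.fst R M N)
    · ext f
      exact LinearMap.congr_fun hxy (f ∘ₗ LinearMap.snd R M N)
  · intro φ
    obtain ⟨x, hx⟩ := hM.2.2.2 (φ ∘ₗ dmap S C (LinearMap.fst R M N))
    obtain ⟨y, hy⟩ := hN.2.2.2 (φ ∘ₗ dmap S C (LinearMap.snd R M N))
    refine ⟨(x, y), ?_⟩
    ext f
    have e : f = dmap S C (LinearMap.fst R M N) (f ∘ₗ LinearMap.inl R M N) +
      dmap S C (LinearMap.snd R M N) (f ∘ₗ LinearMap.inr R M N) := by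
      ext x <;> simp [dmap, Prod.mk_zero_zero]
    have h1 := LinearMap.congr_fun hx (f ∘ₗ LinearMap.inl R M N)
    have h2 := LinearMap.congr_fun hy (f ∘ₗ LinearMap.inr R M N)
    conv_rhs => rw [e, map_add]
    refine Eq.trans ?_ (congrArg₂ (· + ·) h1 h2)
    change f (x, y) = f (x, 0) + f (0, y)
    rw [← map_add]; simp

lemma refl_self (hC : IsSemidualizing R S C) : IsCReflexive R S C R := by
  rw [refl_iff]
  have E : ∀ f : R →ₗ[R] C, LinearMap.toSpanSingleton R C (f 1) = f := by
    intro f; ext; simp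
  let s : (R →ₗ[R] C) →ₗ[Sᵐᵒᵖ] C :=
    { toFun := fun f => f 1, map_add' := fun _ _ => rfl, map_smul' := fun _ _ => rfl }
  let r : C →ₗ[Sᵐᵒᵖ] (R →ₗ[R] C) :=
    { toFun := fun c => LinearMap.toSpanSingleton R C c
      map_add' := fun _ _ => by ext; simp
      map_smul' := fun _ _ => by ext; simp }
  refine ⟨EV_self, EV_retract s r E (EV_iff.2 hC.ext_left), ?_, ?_⟩
  · intro x y hxy
    apply hC.bij_left.1
    ext c
    simpa [bidualityMap, leftHomothety] using LinearMap.congr_fun hxy (LinearMap.toSpanSingleton R C c)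
  · intro φ
    obtain ⟨x, hx⟩ := hC.bij_left.2 (φ ∘ₗ r)
    refine ⟨x, ?_⟩
    ext f
    have := LinearMap.congr_fun hx (f 1)
    change x • f 1 = φ (LinearMap.toSpanSingleton R C (f 1)) at this
    rw [E] at this
    rw [← this, ← map_smul]
    simp [bidualityMap]

lemma refl_fin (hC : IsSemidualizing R S C) (n : ℕ) : IsCReflexive R S C (Fin n → R) := by
  induction n with
  | zero => exact refl_retract 0 0 (fun x => Subsingleton.elim _ _) (refl_self hC)
  | succ n ih =>
    let e := Fin.consLinearEquiv R (fun _ : Fin (n+1) => R)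
    exact refl_retract e.symm.toLinearMap e.toLinearMap (fun x => e.apply_symm_apply x)
      (refl_prod (refl_self hC) ih)

lemma refl_proj (hC : IsSemidualizing R S C) [Module.Finite R M] [Module.Projective R M] :
    IsCReflexive R S C M := by
  obtain ⟨n, f, hf⟩ := Module.Finite.exists_fin' R M
  obtain ⟨g, hg⟩ := Module.projective_lifting_property f LinearMap.id hf
  exact refl_retract g f (fun x => LinearMap.congr_fun hg x) (refl_fin hC n)

lemma refl_ker (i : K →ₗ[R] M) (p : M →ₗ[R] N) (hi : Function.Injective i)
    (h : Function.Exact i p) (hp : Function.Surjective p)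
    (hM : IsCReflexive R S C M) (hN : IsCReflexive R S C N) : IsCReflexive R S C K := by
  rw [refl_iff] at hM hN ⊢
  have hs : Function.Surjective (dmap S C i) := fun f => hom_surj_of_EV i p hi h hp hN.1 f
  have hinj : Function.Injective (dmap S C p) := by
    intro f g hfg
    ext x
    obtain ⟨y, rfl⟩ := hp x
    exact LinearMap.congr_fun hfg y
  have hex : Function.Exact (dmap S C p) (dmap S C i) := by
    intro f
    constructor
    · intro hf
      have hk : LinearMap.ker p ≤ LinearMap.ker f := by
        intro x hx
        obtain ⟨y, rfl⟩ := (h x).1 hx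
        exact LinearMap.congr_fun hf y
      let e := p.quotKerEquivOfSurjective hp
      refine ⟨(LinearMap.ker p).liftQ f hk ∘ₗ e.symm.toLinearMap, ?_⟩
      ext x
      have : e.symm (p x) = Submodule.Quotient.mk x := by
        rw [LinearEquiv.symm_apply_eq]; rfl
      change (LinearMap.ker p).liftQ f hk (e.symm (p x)) = f x
      rw [this]; rfl
    · rintro ⟨g, rfl⟩
      ext x
      change g (p (i x)) = 0
      rw [h.apply_apply_eq_zero, map_zero]
  refine ⟨EV_left i p hi h hp hM.1 hN.1, EV_right _ _ hinj hex hs hN.2.1 hM.2.1 ?_, ?_, ?_⟩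
  · intro φ
    obtain ⟨y, rfl⟩ := hN.2.2.2 φ
    obtain ⟨x, rfl⟩ := hp y
    exact ⟨bidualityMap R S C M x, rfl⟩
  · intro x y hxy
    apply hi
    apply hM.2.2.1
    ext f
    exact LinearMap.congr_fun hxy (f ∘ₗ i)
  · intro φ
    obtain ⟨x, hx⟩ := hM.2.2.2 (φ ∘ₗ dmap S C i)
    have hpx : p x = 0 := by
      apply hN.2.2.1
      ext f
      have := LinearMap.congr_fun hx (f ∘ₗ p)
      refine Eq.trans this ?_
      have e0 : dmap S C i (f ∘ₗ p) = 0 := hex.apply_apply_eq_zero f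
      change φ (dmap S C i (f ∘ₗ p)) = f 0
      rw [e0, map_zero, map_zero]
    obtain ⟨k, rfl⟩ := (h x).1 hpx
    refine ⟨k, ?_⟩
    ext f
    obtain ⟨g, rfl⟩ := hs f
    exact LinearMap.congr_fun hx g

end Refl

section Main

variable {R : Type} [Ring R] [IsNoetherianRing R] {M : Type} [AddCommGroup M] [Module R M]

/-- the shifted resolution of the first syzygy -/
def FGResolution.shift (P : FGResolution R M) : FGResolution R (LinearMap.ker P.aug) where
  X j := P.X (j+1)
  fin j := P.fin (j+1)
  d j := P.d (j+1)
  aug := (P.d 0).codRestrict _ (fun x => P.exact_aug.apply_apply_eq_zero x)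
  surj := by
    rintro ⟨x, hx⟩
    obtain ⟨y, hy⟩ := (P.exact_aug x).1 hx
    exact ⟨y, Subtype.ext hy⟩
  exact_aug := by
    intro x
    rw [← P.exact 0 x, Subtype.ext_iff]
    rfl
  exact j := P.exact (j+1)

section
variable (res P : FGResolution R M) (l : P.X 0 →ₗ[R] res.X 0)

/-- the map `X 1 × P 0 → X 0` -/
abbrev gmap : (res.X 1 × P.X 0) →ₗ[R] res.X 0 := (res.d 0).coprod l

lemma gmap_surj (hl : res.aug ∘ₗ l = P.aug) : Function.Surjective (gmap res P l) := by
  intro x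
  obtain ⟨p, hp⟩ := P.surj (res.aug x)
  obtain ⟨y, hy⟩ := (res.exact_aug (x - l p)).1 (by
    rw [map_sub, ← hp, ← hl]; simp)
  exact ⟨(y, p), by simp [hy]⟩

/-- The modules of the new resolution -/
def newX : ℕ → ModuleCat.{0} R
  | 0 => ModuleCat.of R (LinearMap.ker (gmap res P l))
  | j+1 => ModuleCat.of R (res.X (j+2))


/-- The differentials of the new resolution -/
def newD : ∀ j, newX res P l (j+1) →ₗ[R] newX res P l j
  | 0 => (LinearMap.inl R (res.X 1) (P.X 0) ∘ₗ res.d 1).codRestrict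
      (LinearMap.ker (gmap res P l)) (fun x => by
        simpa using (res.exact 0).apply_apply_eq_zero x)
  | j+1 => res.d (j+2)

/-- The new resolution of the first syzygy. -/
def newRes (hl : res.aug ∘ₗ l = P.aug) : FGResolution R (LinearMap.ker P.aug) where
  X j := newX res P l j
  fin j := by
    have := res.fin
    have := P.fin
    cases j with
    | zero => exact inferInstanceAs (Module.Finite R (LinearMap.ker (gmap res P l)))
    | succ j => exact res.fin (j+2)
  d := newD res P l
  aug := (LinearMap.snd R (res.X 1) (P.X 0) ∘ₗ (LinearMap.ker (gmap res P l)).subtype).codRestrict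
    (LinearMap.ker P.aug) (by
      rintro ⟨⟨x, p⟩, hx⟩
      have hx' : res.d 0 x + l p = 0 := by simpa using hx
      have h2 := congrArg res.aug hx'
      rw [map_add, res.exact_aug.apply_apply_eq_zero, zero_add, map_zero] at h2
      rw [LinearMap.mem_ker, ← hl]
      exact h2)
  surj := by
    rintro ⟨p, hp⟩
    obtain ⟨y, hy⟩ := (res.exact_aug (- l p)).1 (by
      rw [map_neg, neg_eq_zero]
      exact (LinearMap.congr_fun hl p).trans hp)
    exact ⟨⟨(y, p), by simp [hy]⟩, rfl⟩
  exact_aug := by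
    rintro ⟨⟨x, p⟩, hx⟩
    have hx' : res.d 0 x + l p = 0 := by simpa using hx
    constructor
    · intro h
      have hp : p = 0 := congrArg Subtype.val h
      subst hp
      obtain ⟨y, hy⟩ := (res.exact 0 x).1 (by simpa using hx')
      exact ⟨y, Subtype.ext (Prod.ext hy rfl)⟩
    · rintro ⟨y, hy⟩
      have := congrArg (fun z => (Subtype.val z).2) hy
      exact Subtype.ext this.symm
  exact j := by
    cases j with
    | zero =>
      intro x
      refine Iff.trans ?_ (res.exact 1 x)
      constructor
      · intro h
        exact congrArg (fun z => (Subtype.val z).1) h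
      · intro h
        exact Subtype.ext (Prod.ext h rfl)
    | succ j => exact res.exact (j+2)

end

end Main

lemma main_aux {R S : Type} [Ring R] [IsNoetherianRing R] [Ring S]
    {C : Type} [AddCommGroup C] [Module R C] [Module Sᵐᵒᵖ C]
    [SMulCommClass R Sᵐᵒᵖ C] [SMulCommClass Sᵐᵒᵖ R C]
    (hC : IsSemidualizing R S C) (m : ℕ) :
    ∀ (M : Type) [AddCommGroup M] [Module R M] (n : ℕ)
    (res : FGResolution R M) (_ : res.LengthLE R n)
    (_ : ∀ j, IsCReflexive R S C (res.X j))
    (P : FGResolution R M) (_ : ∀ j, Module.Projective R (P.X j)) (_ : n ≤ m),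
    IsCReflexive R S C (P.X m ⧸ LinearMap.range (P.d m)) := by
  induction m with
  | zero =>
    intro M _ _ n res hlen hrefl P hproj hm
    have hsub := hlen 1 (by omega)
    have hinj : Function.Injective res.aug := by
      rw [injective_iff_map_eq_zero]
      intro x hx
      obtain ⟨y, rfl⟩ := (res.exact_aug x).1 hx
      rw [Subsingleton.elim y 0, map_zero]
    let e1 := LinearEquiv.ofBijective res.aug ⟨hinj, res.surj⟩
    have hk : LinearMap.ker P.aug = LinearMap.range (P.d 0) := P.exact_aug.linearMap_ker_eq
    let e2 := (Submodule.quotEquivOfEq _ _ hk.symm).trans (P.aug.quotKerEquivOfSurjective P.surj)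
    let e := e2.trans e1.symm
    exact refl_retract e.toLinearMap e.symm.toLinearMap (fun x => e.symm_apply_apply x) (hrefl 0)
  | succ m ih =>
    intro M _ _ n res hlen hrefl P hproj hm
    have := hproj 0
    have := P.fin 0
    obtain ⟨l, hl⟩ := Module.projective_lifting_property res.aug P.aug res.surj
    refine ih (LinearMap.ker P.aug) (n - 1) (newRes res P l hl) ?_ ?_ P.shift
      (fun j => hproj (j+1)) (by omega)
    · intro j hj
      obtain ⟨k, rfl⟩ : ∃ k, j = k + 1 := ⟨j - 1, by omega⟩
      exact hlen (k+2) (by omega)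
    · intro j
      cases j with
      | zero =>
        exact refl_ker (LinearMap.ker (gmap res P l)).subtype (gmap res P l)
          (Submodule.subtype_injective _) (LinearMap.exact_subtype_ker_map _)
          (gmap_surj res P l hl) (refl_prod (hrefl 1) (refl_proj hC)) (hrefl 0)
      | succ j => exact hrefl (j+2)

/-- if `M` admits a resolution `0 → X^{-n} → ⋯ → X^0 → M → 0` by
`C`-reflexive modules, then for any projective resolution
`⋯ → P^{-m-1} → P^{-m} → ⋯ → P^0 → M → 0` and any `m ≥ n`, the cokernel of
`P^{-m-1} → P^{-m}` is `C`-reflexive. -/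
theorem coker_reflexive_of_resolution
    (R S : Type) [Ring R] [IsNoetherianRing R] [Ring S] [IsNoetherianRing Sᵐᵒᵖ]
    (C : Type) [AddCommGroup C] [Module R C] [Module Sᵐᵒᵖ C]
    [SMulCommClass R Sᵐᵒᵖ C] [SMulCommClass Sᵐᵒᵖ R C]
    [Module.Finite R C] [Module.Finite Sᵐᵒᵖ C]
    (hC : IsSemidualizing R S C)
    (M : Type) [AddCommGroup M] [Module R M] [Module.Finite R M]
    (n : ℕ)
    (res : FGResolution R M) (hlen : res.LengthLE R n)
    (hrefl : ∀ j, IsCReflexive R S C (res.X j))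
    (P : FGResolution R M) (hproj : ∀ j, Module.Projective R (P.X j))
    (m : ℕ) (hm : n ≤ m) :
    IsCReflexive R S C (P.X m ⧸ LinearMap.range (P.d m)) := by
  exact main_aux hC m M n res hlen hrefl P hproj hm
end

section
/- Let C be a semi-dualizing (R,S)-bimodule and M a finitely generated left R-module with G_C-dim_R M finite. Then G_C-dim_R M = sup{ n : Ext^n_R(M,C) ≠ 0 }. -/
open CategoryTheory

namespace GCDim
set_option linter.unusedSectionVars false
open Abelian

lemma sub_iff {A : Type} [Ring A] (n : ℕ) (M N : Type) [AddCommGroup M] [Module A M]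
    [AddCommGroup N] [Module A N] :
    Subsingleton (ExtGrp A (n+1) M N) ↔
      Subsingleton (Abelian.Ext.{0} (ModuleCat.of A M) (ModuleCat.of A N) (n+1)) := by
  let P := projectiveResolution (ModuleCat.of A M)
  have e := (P.isoExt (R := ℤ) (n+1) (ModuleCat.of A N)).toLinearEquiv.toEquiv
  have h1 : Subsingleton (ExtGrp A (n+1) M N) ↔
      ∀ f : P.complex.X (n+1) ⟶ ModuleCat.of A N, P.complex.d (n+2) (n+1) ≫ f = 0 →
        ∃ g : P.complex.X n ⟶ ModuleCat.of A N, P.complex.d (n+1) n ≫ g = f := by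
    rw [e.subsingleton_congr, ← ModuleCat.isZero_iff_subsingleton (R := ℤ),
      ← HomologicalComplex.exactAt_iff_isZero_homology,
      HomologicalComplex.exactAt_iff' _ n (n+1) (n+2) (by simp) (by simp),
      ShortComplex.moduleCat_exact_iff]
    rfl
  rw [h1]
  constructor
  · intro h
    refine ⟨fun a b => ?_⟩
    suffices ∀ a : Abelian.Ext.{0} (ModuleCat.of A M) (ModuleCat.of A N) (n+1), a = 0 by
      rw [this a, this b]
    intro a
    obtain ⟨f, hf, rfl⟩ := P.extMk_surjective a (n+2) rfl
    rw [P.extMk_eq_zero_iff f (n+2) rfl hf n rfl]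
    exact h f hf
  · intro h f hf
    rw [← P.extMk_eq_zero_iff f (n+2) rfl hf n rfl]
    exact Subsingleton.elim _ _

section les
variable {A : Type} [Ring A] {X Y Z : Type} [AddCommGroup X] [Module A X]
    [AddCommGroup Y] [Module A Y] [AddCommGroup Z] [Module A Z]
    (f : X →ₗ[A] Y) (g : Y →ₗ[A] Z) (hf : Function.Injective f) (hg : Function.Surjective g)
    (hfg : Function.Exact f g) (C : Type) [AddCommGroup C] [Module A C]

/-- short complex -/
noncomputable def sc (hfg : Function.Exact f g) : ShortComplex (ModuleCat.{0} A) :=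
  ShortComplex.mk (ModuleCat.ofHom f) (ModuleCat.ofHom g) (by
    ext x; exact hfg.apply_apply_eq_zero x)

include hf hg in
lemma sc_exact : (sc f g hfg).ShortExact :=
  { exact := by
      rw [ShortComplex.moduleCat_exact_iff]
      intro x hx
      exact (hfg x).1 hx
    mono_f := (ModuleCat.mono_iff_injective _).2 hf
    epi_g := (ModuleCat.epi_iff_surjective _).2 hg }

include f g hf hg hfg

lemma ext_Z (n : ℕ) (hX : Subsingleton (ExtGrp A (n+1) X C))
    (hY : Subsingleton (ExtGrp A (n+2) Y C)) : Subsingleton (ExtGrp A (n+2) Z C) := by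
  rw [sub_iff] at *
  refine ⟨fun a b => ?_⟩
  suffices ∀ a : Abelian.Ext.{0} (ModuleCat.of A Z) (ModuleCat.of A C) (n+2), a = 0 by
    rw [this a, this b]
  intro a
  obtain ⟨x, hx⟩ := Abelian.Ext.contravariant_sequence_exact₃ (sc_exact f g hf hg hfg) _ a
    (hY.elim _ _) (n₀ := n+1) (by omega)
  rw [← hx, show x = 0 from hX.elim x 0]
  exact Abelian.Ext.comp_zero _ _ _ _ _

lemma ext_Y (n : ℕ) (hX : Subsingleton (ExtGrp A (n+1) X C))
    (hZ : Subsingleton (ExtGrp A (n+1) Z C)) : Subsingleton (ExtGrp A (n+1) Y C) := by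
  rw [sub_iff] at *
  refine ⟨fun a b => ?_⟩
  suffices ∀ a : Abelian.Ext.{0} (ModuleCat.of A Y) (ModuleCat.of A C) (n+1), a = 0 by
    rw [this a, this b]
  intro a
  obtain ⟨x, hx⟩ := Abelian.Ext.contravariant_sequence_exact₂ (sc_exact f g hf hg hfg) _ a
    (hX.elim _ _)
  rw [← hx, show x = 0 from hZ.elim x 0]
  exact Abelian.Ext.comp_zero _ _ _ _ _

lemma ext_X (n : ℕ) (hY : Subsingleton (ExtGrp A (n+1) Y C))
    (hZ : Subsingleton (ExtGrp A (n+2) Z C)) : Subsingleton (ExtGrp A (n+1) X C) := by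
  rw [sub_iff] at *
  refine ⟨fun a b => ?_⟩
  suffices ∀ a : Abelian.Ext.{0} (ModuleCat.of A X) (ModuleCat.of A C) (n+1), a = 0 by
    rw [this a, this b]
  intro a
  obtain ⟨x, hx⟩ := Abelian.Ext.contravariant_sequence_exact₁ (sc_exact f g hf hg hfg) _ a
    (n₁ := n+2) (by omega) (hZ.elim _ _)
  rw [← hx, show x = 0 from hY.elim x 0]
  exact Abelian.Ext.comp_zero _ _ _ _ _

lemma hom_lift (hZ : Subsingleton (ExtGrp A 1 Z C)) (u : X →ₗ[A] C) :
    ∃ v : Y →ₗ[A] C, v ∘ₗ f = u := by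
  rw [sub_iff] at hZ
  obtain ⟨x, hx⟩ := Abelian.Ext.contravariant_sequence_exact₁ (sc_exact f g hf hg hfg) 
    (ModuleCat.of A C) (Abelian.Ext.mk₀ (ModuleCat.ofHom u))
    (n₁ := 1) (by omega) (hZ.elim _ _)
  obtain ⟨v, rfl⟩ := (Abelian.Ext.mk₀_bijective _ _).2 x
  rw [Abelian.Ext.mk₀_comp_mk₀] at hx
  have := (Abelian.Ext.mk₀_bijective _ _).1 hx
  exact ⟨v.hom, congrArg ModuleCat.Hom.hom this⟩

omit hf in
lemma hom_desc (u : Y →ₗ[A] C) (hu : u ∘ₗ f = 0) : ∃ v : Z →ₗ[A] C, v ∘ₗ g = u := by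
  have hk : LinearMap.ker g ≤ LinearMap.ker u := by
    intro y hy
    obtain ⟨x, rfl⟩ := (hfg y).1 hy
    exact LinearMap.congr_fun hu x
  refine ⟨((LinearMap.ker g).liftQ u hk) ∘ₗ (g.quotKerEquivOfSurjective hg).symm.toLinearMap, ?_⟩
  ext y
  have : (g.quotKerEquivOfSurjective hg).symm (g y) = (LinearMap.ker g).mkQ y := by
    rw [LinearEquiv.symm_apply_eq]; rfl
  simp [this]

end les

lemma ext_zero {A : Type} [Ring A] (n : ℕ) (M N : Type) [AddCommGroup M] [Module A M]
    [AddCommGroup N] [Module A N] [Subsingleton M] : Subsingleton (ExtGrp A (n+1) M N) := by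
  rw [sub_iff]
  have : Projective (ModuleCat.of A M) :=
    (ModuleCat.isZero_of_subsingleton (ModuleCat.of A M)).projective
  exact Abelian.Ext.subsingleton_of_projective _ _ n

section refl
variable {R S : Type} [Ring R] [Ring S]
  {C : Type} [AddCommGroup C] [Module R C] [Module Sᵐᵒᵖ C]
  [SMulCommClass R Sᵐᵒᵖ C] [SMulCommClass Sᵐᵒᵖ R C]

lemma refl_zero (M : Type) [AddCommGroup M] [Module R M] [Subsingleton M] :
    IsCReflexive R S C M := by
  have h2 : Subsingleton (M →ₗ[R] C) := ⟨fun a b => by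
    ext x; rw [Subsingleton.elim x 0, map_zero, map_zero]⟩
  refine ⟨fun i hi => ?_, fun i hi => ?_, fun a b _ => Subsingleton.elim _ _, fun f => ⟨0, ?_⟩⟩
  · obtain ⟨i, rfl⟩ := Nat.exists_eq_add_of_lt hi
    simpa using ext_zero _ _ _
  · obtain ⟨i, rfl⟩ := Nat.exists_eq_add_of_lt hi
    simpa using ext_zero _ _ _
  · ext x; rw [Subsingleton.elim x 0, map_zero, map_zero]

/-- precomposition -/
def dualMap (S : Type) [Ring S] (C : Type) [AddCommGroup C] [Module R C] [Module Sᵐᵒᵖ C]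
  [SMulCommClass R Sᵐᵒᵖ C] {X Y : Type} [AddCommGroup X] [Module R X]
    [AddCommGroup Y] [Module R Y] (f : X →ₗ[R] Y) : (Y →ₗ[R] C) →ₗ[Sᵐᵒᵖ] (X →ₗ[R] C) where
  toFun u := u ∘ₗ f
  map_add' _ _ := rfl
  map_smul' _ _ := rfl

lemma refl_quot {X Y Z : Type} [AddCommGroup X] [Module R X]
    [AddCommGroup Y] [Module R Y] [AddCommGroup Z] [Module R Z]
    (f : X →ₗ[R] Y) (g : Y →ₗ[R] Z) (hf : Function.Injective f) (hg : Function.Surjective g)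
    (hfg : Function.Exact f g) (hX : IsCReflexive R S C X) (hY : IsCReflexive R S C Y)
    (h1 : Subsingleton (ExtGrp R 1 Z C)) : IsCReflexive R S C Z := by
  have dg : Function.Injective (dualMap S C g) := by
    intro a b hab
    ext z
    obtain ⟨y, rfl⟩ := hg z
    exact LinearMap.congr_fun hab y
  have df : Function.Surjective (dualMap S C f) := hom_lift f g hf hg hfg C h1
  have dd : Function.Exact (dualMap S C g) (dualMap S C f) := by
    intro u
    constructor
    · intro hu
      exact hom_desc f g hg hfg C u hu
    · rintro ⟨v, rfl⟩
      ext x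
      change v (g (f x)) = 0
      rw [hfg.apply_apply_eq_zero, map_zero]
  refine ⟨?_, ?_, ?_, ?_⟩
  · intro i hi
    match i, hi with
    | 1, _ => exact h1
    | n+2, _ => exact ext_Z f g hf hg hfg C n (hX.ext_vanish _ (by omega)) (hY.ext_vanish _ (by omega))
  · intro i hi
    match i, hi with
    | n+1, _ => exact ext_X _ _ dg df dd C n (hY.ext_dual_vanish _ (by omega)) (hX.ext_dual_vanish _ (by omega))
  · intro a b hab
    obtain ⟨a, rfl⟩ := hg a
    obtain ⟨b, rfl⟩ := hg b
    rw [← sub_eq_zero, ← map_sub]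
    set y := a - b with hy
    -- evaluation at y restricted to the dual of Z vanishes
    obtain ⟨v, hv⟩ := hom_desc _ _ df dd C (bidualityMap R S C Y y) (by
      ext u
      have := LinearMap.congr_fun hab u
      change u (g a) = u (g b) at this
      change u (g y) = 0
      rw [hy, map_sub, map_sub, this, sub_self])
    obtain ⟨x, rfl⟩ := hX.bij.2 v
    have : f x = y := by
      apply hY.bij.1
      rw [← hv]
      rfl
    rw [← this, hfg.apply_apply_eq_zero]
  · intro w
    obtain ⟨v, hv⟩ := hom_lift _ _ dg df dd C (hX.ext_dual_vanish 1 (by omega)) w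
    obtain ⟨y, rfl⟩ := hY.bij.2 v
    exact ⟨g y, hv⟩

variable (R S C) in
/-- Inductive form of having a reflexive resolution of length at most `n`. -/
def GD : ℕ → ∀ (M : Type) [AddCommGroup M] [Module R M], Prop
  | 0, M, _, _ => ∃ (X : Type) (_ : AddCommGroup X) (_ : Module R X), Module.Finite R X ∧
      IsCReflexive R S C X ∧ Nonempty (X ≃ₗ[R] M)
  | n+1, M, _, _ => ∃ (K X : Type) (_ : AddCommGroup K) (_ : Module R K)
      (_ : AddCommGroup X) (_ : Module R X) (f : K →ₗ[R] X) (g : X →ₗ[R] M),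
      Module.Finite R X ∧ IsCReflexive R S C X ∧ Function.Injective f ∧ Function.Surjective g ∧
      Function.Exact f g ∧ GD n K

lemma GD.of_res (n : ℕ) : ∀ (M : Type) [AddCommGroup M] [Module R M] (res : FGResolution R M),
    res.LengthLE R n → (∀ j, IsCReflexive R S C (res.X j)) → GD R S C n M := by
  induction n with
  | zero =>
    intro M _ _ res hl hr
    have := hl 1 (by omega)
    refine ⟨res.X 0, _, _, res.fin 0, hr 0, ⟨LinearEquiv.ofBijective res.aug ⟨?_, res.surj⟩⟩⟩
    rw [injective_iff_map_eq_zero]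
    intro x hx
    obtain ⟨y, rfl⟩ := (res.exact_aug x).1 hx
    rw [Subsingleton.elim y 0, map_zero]
  | succ n ih =>
    intro M _ _ res hl hr
    refine ⟨LinearMap.ker res.aug, res.X 0, _, _, _, _, (LinearMap.ker res.aug).subtype, res.aug,
      res.fin 0, hr 0, Subtype.val_injective, res.surj, ?_, ?_⟩
    · exact LinearMap.exact_subtype_ker_map res.aug
    · refine ih _ { X := fun j => res.X (j+1)
                    fin := fun j => res.fin (j+1)
                    d := fun j => res.d (j+1)
                    aug := (res.d 0).codRestrict _ (fun x => res.exact_aug.apply_apply_eq_zero x)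
                    surj := ?_
                    exact_aug := ?_
                    exact := fun j => res.exact (j+1) } ?_ ?_
      · rintro ⟨x, hx⟩
        obtain ⟨y, rfl⟩ := (res.exact_aug x).1 hx
        exact ⟨y, rfl⟩
      · intro x
        rw [← res.exact 0 x, Subtype.ext_iff]
        rfl
      · intro j hj
        exact hl (j+1) (by omega)
      · exact fun j => hr (j+1)

/-- modules of the spliced resolution -/
def spX (X : Type) (T : ℕ → Type) : ℕ → Type
  | 0 => X
  | j+1 => T j

instance spG (X : Type) (T : ℕ → Type) [h : AddCommGroup X] [h' : ∀ j, AddCommGroup (T j)] :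
    ∀ j, AddCommGroup (spX X T j)
  | 0 => h
  | j+1 => h' j

instance spM (X : Type) (T : ℕ → Type) [AddCommGroup X] [∀ j, AddCommGroup (T j)]
    [h : Module R X] [h' : ∀ j, Module R (T j)] :
    ∀ j, Module R (spX X T j)
  | 0 => h
  | j+1 => h' j

/-- Splicing. -/
def splice {K X M : Type} [AddCommGroup K] [Module R K] [AddCommGroup X] [Module R X]
    [AddCommGroup M] [Module R M] (f : K →ₗ[R] X) (g : X →ₗ[R] M)
    (hX : Module.Finite R X) (hf : Function.Injective f) (hg : Function.Surjective g)
    (hfg : Function.Exact f g) (res : FGResolution R K) : FGResolution R M where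
  X := spX X res.X
  fin j := match j with
    | 0 => hX
    | j+1 => res.fin j
  d j := match j with
    | 0 => f ∘ₗ res.aug
    | j+1 => res.d j
  aug := g
  surj := hg
  exact_aug := by
    intro x
    refine (hfg x).trans ?_
    constructor
    · rintro ⟨y, rfl⟩
      obtain ⟨z, rfl⟩ := res.surj y
      exact ⟨z, rfl⟩
    · rintro ⟨y, rfl⟩
      exact ⟨res.aug y, rfl⟩
  exact j := match j with
    | 0 => by
      intro x
      exact (map_eq_zero_iff f hf).trans (res.exact_aug x)
    | j+1 => res.exact j

/-- Zero resolution. -/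
def zeroRes (R : Type) [Ring R] : FGResolution R PUnit.{1} where
  X _ := PUnit
  fin _ := inferInstance
  d _ := 0
  aug := 0
  surj x := ⟨0, Subsingleton.elim _ _⟩
  exact_aug x := ⟨fun _ => ⟨0, Subsingleton.elim _ _⟩, fun _ => Subsingleton.elim _ _⟩
  exact _ x := ⟨fun _ => ⟨0, Subsingleton.elim _ _⟩, fun _ => Subsingleton.elim _ _⟩

lemma GD.to_res (n : ℕ) : ∀ (M : Type) [AddCommGroup M] [Module R M], GD R S C n M →
    ∃ res : FGResolution R M, res.LengthLE R n ∧ ∀ j, IsCReflexive R S C (res.X j) := by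
  induction n with
  | zero =>
    rintro M _ _ ⟨X, _, _, hX, hr, ⟨e⟩⟩
    refine ⟨splice (K := PUnit) 0 e.toLinearMap hX (fun _ _ _ => rfl) e.surjective ?_ (zeroRes R),
      ?_, ?_⟩
    · intro x
      constructor
      · intro h
        exact ⟨0, ((map_eq_zero_iff e e.injective).1 h).symm⟩
      · rintro ⟨y, rfl⟩
        simp
    · intro j hj
      match j, hj with
      | j+1, _ => exact inferInstanceAs (Subsingleton PUnit)
    · intro j
      match j with
      | 0 => exact hr
      | j+1 => exact refl_zero PUnit
  | succ n ih =>
    rintro M _ _ ⟨K, X, _, _, _, _, f, g, hX, hr, hf, hg, hfg, hK⟩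
    obtain ⟨res, hl, hres⟩ := ih K hK
    refine ⟨splice f g hX hf hg hfg res, ?_, ?_⟩
    · intro j hj
      match j, hj with
      | j+1, hj => exact hl j (by omega)
    · intro j
      match j with
      | 0 => exact hr
      | j+1 => exact hres j

lemma ext_congr {A : Type} [Ring A] (n : ℕ) {M M' N : Type} [AddCommGroup M] [Module A M]
    [AddCommGroup M'] [Module A M'] [AddCommGroup N] [Module A N] (e : M ≃ₗ[A] M')
    (h : Subsingleton (ExtGrp A (n+1) M N)) : Subsingleton (ExtGrp A (n+1) M' N) := by
  refine ext_Y (0 : PUnit →ₗ[A] M') e.symm.toLinearMap (fun _ _ _ => rfl) e.symm.surjective ?_ N n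
    (ext_zero _ _ _) h
  intro x
  constructor
  · intro h
    exact ⟨0, ((map_eq_zero_iff e.symm e.symm.injective).1 h).symm⟩
  · rintro ⟨y, rfl⟩
    simp

lemma GD.ext_vanish (n : ℕ) : ∀ (M : Type) [AddCommGroup M] [Module R M], GD R S C n M →
    ∀ i, n < i → Subsingleton (ExtGrp R i M C) := by
  induction n with
  | zero =>
    rintro M _ _ ⟨X, _, _, hX, hr, ⟨e⟩⟩ i hi
    match i, hi with
    | i+1, _ => exact ext_congr i e (hr.ext_vanish _ (by omega))
  | succ n ih =>
    rintro M _ _ ⟨K, X, _, _, _, _, f, g, hX, hr, hf, hg, hfg, hK⟩ i hi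
    match i, hi with
    | i+2, hi =>
      exact ext_Z f g hf hg hfg C i (ih K hK _ (by omega)) (hr.ext_vanish _ (by omega))

lemma GD.drop (n : ℕ) : ∀ (M : Type) [AddCommGroup M] [Module R M], Module.Finite R M →
    GD R S C (n+1) M → Subsingleton (ExtGrp R (n+1) M C) → GD R S C n M := by
  induction n with
  | zero =>
    rintro M _ _ hM ⟨K, X, _, _, _, _, f, g, hX, hr, hf, hg, hfg, ⟨L, _, _, hL, hrL, ⟨e⟩⟩⟩ h
    refine ⟨M, _, _, hM, ?_, ⟨LinearEquiv.refl _ _⟩⟩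
    refine refl_quot (f ∘ₗ e.toLinearMap) g (hf.comp e.injective) hg ?_ hrL hr h
    intro x
    rw [hfg x]
    constructor
    · rintro ⟨y, rfl⟩
      exact ⟨e.symm y, by simp⟩
    · rintro ⟨y, rfl⟩
      exact ⟨e y, rfl⟩
  | succ n ih =>
    rintro M _ _ hM ⟨K, X, _, _, _, _, f, g, hX, hr, hf, hg, hfg, hK⟩ h
    refine ⟨K, X, _, _, _, _, f, g, hX, hr, hf, hg, hfg, ih K ?_ hK ?_⟩
    · obtain ⟨res, -, -⟩ := GD.to_res _ K hK
      have := res.fin 0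
      exact Module.Finite.of_surjective res.aug res.surj
    · exact ext_X f g hf hg hfg C n (hr.ext_vanish _ (by omega)) h

end refl
end GCDim

/-- if `G_C-dim_R M` is finite then it equals
`sup { n | Ext^n_R(M,C) ≠ 0 }`. -/
theorem gcdim_eq_sup_ext
    (R S : Type) [Ring R] [IsNoetherianRing R] [Ring S] [IsNoetherianRing Sᵐᵒᵖ]
    (C : Type) [AddCommGroup C] [Module R C] [Module Sᵐᵒᵖ C]
    [SMulCommClass R Sᵐᵒᵖ C] [SMulCommClass Sᵐᵒᵖ R C]
    [Module.Finite R C] [Module.Finite Sᵐᵒᵖ C]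
    (hC : IsSemidualizing R S C)
    (M : Type) [AddCommGroup M] [Module R M] [Module.Finite R M]
    (hfin : ∃ n : ℕ, ∃ res : FGResolution R M,
      res.LengthLE R n ∧ ∀ j, IsCReflexive R S C (res.X j)) :
    sInf {n : ℕ | ∃ res : FGResolution R M,
        res.LengthLE R n ∧ ∀ j, IsCReflexive R S C (res.X j)} =
      sSup {n : ℕ | ¬ Subsingleton (ExtGrp R n M C)} := by
  have hset : {n : ℕ | ∃ res : FGResolution R M,
        res.LengthLE R n ∧ ∀ j, IsCReflexive R S C (res.X j)} = {n | GCDim.GD R S C n M} := by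
    ext n
    exact ⟨fun ⟨res, h1, h2⟩ => GCDim.GD.of_res n M res h1 h2, fun h => GCDim.GD.to_res n M h⟩
  have hne : {n : ℕ | GCDim.GD R S C n M}.Nonempty := by
    rw [← hset]; exact hfin
  rw [hset]
  have hN := Nat.sInf_mem hne
  have hmin : ∀ m, GCDim.GD R S C m M → sInf {n | GCDim.GD R S C n M} ≤ m :=
    fun m hm => Nat.sInf_le hm
  generalize sInf {n | GCDim.GD R S C n M} = N at hN hmin
  have hN : GCDim.GD R S C N M := hN
  have hub : ∀ i ∈ {n : ℕ | ¬ Subsingleton (ExtGrp R n M C)}, i ≤ N := by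
    intro i hi
    by_contra hlt
    exact hi (GCDim.GD.ext_vanish N M hN i (by omega))
  apply le_antisymm
  · cases N with
    | zero => exact Nat.zero_le _
    | succ k =>
      apply le_csSup ⟨_, hub⟩
      intro h
      have := hmin k (GCDim.GD.drop k M inferInstance hN h)
      omega
  · by_cases he : {n : ℕ | ¬ Subsingleton (ExtGrp R n M C)}.Nonempty
    · exact csSup_le he hub
    · rw [Set.not_nonempty_iff_eq_empty.1 he]
      simp
end
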